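/- arXiv:2009.01301 — 4 statements merged into one kernel-verified Lean document; each statement's English description precedes it below -/
import Mathlib

section
/- Let p be a prime, G a finite group, and P a Sylow p-subgroup of G. Then G has property L_p if and only if P has property L_p. -/
/-- The natural reduction ring homomorphism `W₂(k) → k` from length-two `p`-typical
Witt vectors to `k`, given by the zeroth coefficient. -/
noncomputable def wittReduce (p : ℕ) [Fact p.Prime] (k : Type*) [CommRing k] :
    TruncatedWittVector p 2 k →+* k :=
  RingHom.liftOfRightInverse (WittVector.truncate 2) TruncatedWittVector.out
    TruncatedWittVector.truncateFun_out
    ⟨WittVector.constantCoeff, fun x hx => by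
      rw [WittVector.mem_ker_truncate] at hx
      simpa [RingHom.mem_ker] using hx 0 (by norm_num)⟩

/-- A finite group `G` has property `L_p` if every homomorphism `G → GL_n(k)`, for `k` a
finite field of characteristic `p`, lifts to `GL_n(W₂(k))`. -/
def HasLp (p : ℕ) [Fact p.Prime] (G : Type*) [Group G] : Prop :=
  ∀ (n : ℕ), 1 ≤ n → ∀ (k : Type) [Field k] [Fintype k] [CharP k p],
    ∀ f : G →* GL (Fin n) k,
      ∃ g : G →* GL (Fin n) (TruncatedWittVector p 2 k),
        (Matrix.GeneralLinearGroup.map (wittReduce p k)).comp g = f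

/-- A group has property `L` if it has property `L_p` for every prime `p`. -/
def HasL (G : Type*) [Group G] : Prop :=
  ∀ (p : ℕ) [Fact p.Prime], HasLp p G

section SquareZeroKernel

variable {A B : Type*} [Ring A] [Ring B] {φ : A →+* B}

theorem isUnit_of_map_of_mul_ker_eq_zero (hφ : Function.Surjective φ)
    (hker : ∀ x y, φ x = 0 → φ y = 0 → x * y = 0) {a : A} (ha : IsUnit (φ a)) : IsUnit a := by
  obtain ⟨b, hab, hba⟩ := isUnit_iff_exists.mp ha
  obtain ⟨c, rfl⟩ := hφ b
  have key : ∀ z, φ z = 1 → IsUnit z := fun z hz => by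
    have h0 : φ (z - 1) = 0 := by simp [hz]
    have hnil : IsNilpotent (z - 1) := ⟨2, by rw [pow_two, hker _ _ h0 h0]⟩
    simpa using hnil.isUnit_one_add
  obtain ⟨u, hu⟩ := key (a * c) (by simpa using hab)
  obtain ⟨v, hv⟩ := key (c * a) (by simpa using hba)
  refine isUnit_iff_exists_and_exists.mpr ⟨⟨c * ↑u⁻¹, ?_⟩, ⟨↑v⁻¹ * c, ?_⟩⟩
  · rw [← mul_assoc, ← hu, Units.mul_inv]
  · rw [mul_assoc, ← hv, Units.inv_mul]

/-- A homomorphism to the target of a surjection with square-zero kernel lifts as soon as its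
restriction to a subgroup of invertible index lifts. -/
theorem exists_monoidHom_lift_of_subgroup {G : Type*} [Group G] (H : Subgroup G) [H.FiniteIndex]
    (hφ : Function.Surjective φ) (hker : ∀ x y, φ x = 0 → φ y = 0 → x * y = 0)
    (hindex : IsUnit (H.index : B)) (f : G →* B) (g : H →* A) (hg : ∀ h, φ (g h) = f h) :
    ∃ F : G →* A, ∀ x, φ (F x) = f x := by
  classical
  let := Fintype.ofFinite (G ⧸ H)
  have hlift : ∀ x, ∃ e : Aˣ, φ e = f x := fun x => by
    obtain ⟨a, ha⟩ := hφ (f x)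
    have hu : IsUnit a := isUnit_of_map_of_mul_ker_eq_zero hφ hker
      (ha ▸ (Group.isUnit x).map f)
    exact ⟨hu.unit, ha⟩
  choose e he using hlift
  -- a set-theoretic lift of `f`, equivariant for right multiplication by `H`
  obtain ⟨σ, hσf, hσmul⟩ : ∃ σ : G → Aˣ, (∀ x, φ (σ x) = f x) ∧
      ∀ x (h : H), σ (x * h) = σ x * g.toHomUnits h := by
    have hmem : ∀ x : G, (x : G ⧸ H).out⁻¹ * x ∈ H := fun x =>
      QuotientGroup.eq.mp (QuotientGroup.out_eq' _)
    refine ⟨fun x => e (x : G ⧸ H).out * g.toHomUnits ⟨_, hmem x⟩, fun x => ?_, fun x h => ?_⟩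
    · simp only [Units.val_mul, MonoidHom.coe_toHomUnits, map_mul, he, hg]
      rw [← map_mul, ← map_mul, mul_inv_cancel_left]
    · have hq : ((x * h : G) : G ⧸ H) = x := QuotientGroup.mk_mul_of_mem x h.2
      simp only [hq]
      rw [mul_assoc, ← map_mul]
      congr 2
      ext
      simp [mul_assoc]
  let a : G → G ⧸ H → A := fun x z => ↑(σ (x * z.out) * (σ z.out)⁻¹)
  have ha : ∀ x y : G, a x y = ↑(σ (x * y) * (σ y)⁻¹) := fun x y => by
    obtain ⟨h, hh⟩ := QuotientGroup.mk_out_eq_mul H y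
    simp only [a, hh, ← mul_assoc, hσmul]
    simp
  have hφa : ∀ x z, φ (a x z) = f x := fun x z => by
    have h1 : a x z * σ z.out = σ (x * z.out) := by simp [a]
    have h2 := congrArg φ h1
    rw [map_mul, hσf, hσf, map_mul] at h2
    exact ((Group.isUnit z.out).map f).mul_right_cancel h2
  have hmul : ∀ x y w, a x (y • w) * a y w = a (x * y) w := fun x y w => by
    induction w using QuotientGroup.induction_on with
    | H w =>
      rw [MulAction.Quotient.smul_coe, smul_eq_mul, ha, ha, ha, ← Units.val_mul]
      simp [mul_assoc]
  have hunit : IsUnit (H.index : A) :=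
    isUnit_of_map_of_mul_ker_eq_zero hφ hker (by simpa using hindex)
  obtain ⟨u, hu⟩ := hunit
  have hcard : (Fintype.card (G ⧸ H) : A) = u := by
    rw [hu, Subgroup.index, Nat.card_eq_fintype_card]
  have hcomm : ∀ b : A, ↑u⁻¹ * b = b * ↑u⁻¹ := fun b =>
    (Commute.units_inv_left (hu ▸ Nat.cast_commute _ b)).eq
  let S : G → A := fun x => ∑ z, a x z
  have hS : ∀ x, φ (↑u⁻¹ * S x) = f x := fun x => by
    have h1 : φ (S x) = φ u * f x := by simp [S, hφa, ← hcard]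
    rw [map_mul, h1, ← mul_assoc, ← map_mul]
    simp
  refine ⟨{ toFun := fun x => ↑u⁻¹ * S x, map_one' := ?_, map_mul' := fun x y => ?_ }, hS⟩
  · simp [S, a, hcard]
  · have h0 : ∑ w, (a x (y • w) - ↑u⁻¹ * S x) * (a y w - ↑u⁻¹ * S y) = 0 :=
      Finset.sum_eq_zero fun w _ => hker _ _ (by rw [map_sub, hS, hφa, sub_self])
        (by rw [map_sub, hS, hφa, sub_self])
    have hperm : ∑ w, a x (y • w) = S x := Equiv.sum_comp (MulAction.toPerm y) (a x)
    simp only [sub_mul, mul_sub, Finset.sum_sub_distrib, hmul, ← Finset.sum_mul, ← Finset.mul_sum,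
      hperm, Finset.sum_const, Finset.card_univ, nsmul_eq_mul, hcard] at h0
    change S (x * y) - ↑u⁻¹ * S x * S y - (S x * (↑u⁻¹ * S y) - _) = 0 at h0
    rw [Units.mul_inv, one_mul, sub_self, sub_zero,
      sub_eq_zero] at h0
    change ↑u⁻¹ * S (x * y) = ↑u⁻¹ * S x * (↑u⁻¹ * S y)
    rw [h0, ← mul_assoc _ (↑u⁻¹ * S x), hcomm (↑u⁻¹ * S x), mul_assoc]

end SquareZeroKernel

section Induction

variable {G : Type*} [Group G] (H : Subgroup G)

open Classical in
/-- Extension by zero of a function on a subgroup. -/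
noncomputable def Subgroup.extendZero {B : Type*} [Zero B] (f : H → B) (x : G) : B :=
  if h : x ∈ H then f ⟨x, h⟩ else 0

variable {H} {B : Type*} [Semiring B]

theorem Subgroup.extendZero_coe (f : H → B) (h : H) : H.extendZero f h = f h := by
  simp [extendZero]

theorem Subgroup.extendZero_of_notMem (f : H → B) {x : G} (hx : x ∉ H) :
    H.extendZero f x = 0 := by
  simp [extendZero, hx]

theorem Subgroup.extendZero_mul (f : H →* B) {x : G} (hx : x ∈ H) (y : G) :
    H.extendZero f (x * y) = H.extendZero f x * H.extendZero f y := by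
  by_cases hy : y ∈ H
  · simp [extendZero, hx, hy, H.mul_mem hx hy, ← map_mul]
  · simp [extendZero, hx, hy, H.mul_mem_cancel_left hx]

theorem Subgroup.out_inv_mul_out_mem_iff {a b : G ⧸ H} : a.out⁻¹ * b.out ∈ H ↔ a = b := by
  rw [← QuotientGroup.eq, QuotientGroup.out_eq', QuotientGroup.out_eq']

open Classical in
/-- The matrix form of the representation induced from a subgroup. -/
noncomputable def Subgroup.inducedMatrix [Fintype (G ⧸ H)] (f : H →* B) :
    G →* Matrix (G ⧸ H) (G ⧸ H) B where
  toFun x := Matrix.of fun a b => H.extendZero f (a.out⁻¹ * x * b.out)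
  map_one' := by
    ext a b
    by_cases hab : a = b
    · subst hab
      simpa using extendZero_coe f 1
    · rw [Matrix.one_apply_ne hab, Matrix.of_apply, mul_one]
      exact extendZero_of_notMem _ (by rwa [out_inv_mul_out_mem_iff])
  map_mul' x y := by
    ext a c
    rw [Matrix.mul_apply, Finset.sum_eq_single ((x⁻¹ * a.out : G) : G ⧸ H)]
    · have hmem : a.out⁻¹ * x * ((x⁻¹ * a.out : G) : G ⧸ H).out ∈ H := by
        simpa using QuotientGroup.eq.mp (QuotientGroup.out_eq' ((x⁻¹ * a.out : G) : G ⧸ H)).symm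
      simp only [Matrix.of_apply]
      rw [← extendZero_mul f hmem]
      congr 1
      group
    · intro b _ hb
      simp only [Matrix.of_apply]
      rw [extendZero_of_notMem, zero_mul]
      contrapose! hb
      rw [← QuotientGroup.out_eq' b, eq_comm, QuotientGroup.eq]
      simpa using hb
    · simp

/-- If the representation induced from a subgroup lifts along a ring homomorphism with
square-zero kernel, then so does the original representation: it is a direct summand of the
restriction of the induced one. -/
theorem Subgroup.exists_lift_of_inducedMatrix_lift [Fintype (G ⧸ H)] [DecidableEq (G ⧸ H)]
    {A : Type*} [Ring A] {B : Type*} [Ring B] {φ : A →+* B}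
    (hker : ∀ x y, φ x = 0 → φ y = 0 → x * y = 0) (f : H →* B)
    (F : G →* Matrix (G ⧸ H) (G ⧸ H) A) (hF : ∀ x, φ.mapMatrix (F x) = H.inducedMatrix f x) :
    ∃ g : H →* A, ∀ h, φ (g h) = f h := by
  let q : G ⧸ H := (1 : G)
  have hq : q.out ∈ H := by
    simpa using QuotientGroup.eq.mp (QuotientGroup.out_eq' q).symm
  let c : G → G := fun x => q.out * x * q.out⁻¹
  have hφF : ∀ x a b, φ (F x a b) = H.extendZero f (a.out⁻¹ * x * b.out) := fun x a b =>
    congrFun (congrFun (hF x) a) b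
  have hc : ∀ h : H, c h ∈ H := fun h => H.mul_mem (H.mul_mem hq h.2) (H.inv_mem hq)
  have hrow : ∀ h : H, ∀ b, b ≠ q → φ (F (c h) q b) = 0 := fun h b hb => by
    rw [hφF]
    refine extendZero_of_notMem _ fun hmem => hb ?_
    rw [mul_assoc, H.mul_mem_cancel_left (H.inv_mem hq), H.mul_mem_cancel_left (hc h)] at hmem
    rw [← QuotientGroup.out_eq' b, eq_comm, QuotientGroup.eq]
    simpa using hmem
  have hcol : ∀ h : H, ∀ b, b ≠ q → φ (F (c h) b q) = 0 := fun h b hb => by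
    rw [hφF]
    refine extendZero_of_notMem _ fun hmem => hb ?_
    rw [H.mul_mem_cancel_right hq, H.mul_mem_cancel_right (hc h), H.inv_mem_iff] at hmem
    rw [← QuotientGroup.out_eq' b, eq_comm, QuotientGroup.eq]
    simpa using hmem
  refine ⟨{ toFun := fun h => F (c h) q q, map_one' := by simp [c], map_mul' := fun x y => ?_ },
    fun h => ?_⟩
  · have hcmul : c ↑(x * y) = c x * c y := by simp [c, mul_assoc]
    rw [hcmul, map_mul, Matrix.mul_apply, Finset.sum_eq_single q]
    · exact fun b _ hb => hker _ _ (hrow x b hb) (hcol y b hb)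
    · simp
  · change φ (F (c h) q q) = f h
    rw [hφF, ← extendZero_coe f h]
    congr 1
    simp [c, mul_assoc]

end Induction

section WittReduction

variable (p : ℕ) [Fact p.Prime] (k : Type*) [CommRing k]

theorem wittReduce_truncate (x : WittVector p k) :
    wittReduce p k (WittVector.truncate 2 x) = x.coeff 0 :=
  RingHom.liftOfRightInverse_comp_apply _ _ _ _ x

theorem wittReduce_surjective : Function.Surjective (wittReduce p k) := fun a =>
  ⟨WittVector.truncate 2 (WittVector.teichmuller p a), by
    rw [wittReduce_truncate, WittVector.teichmuller_coeff_zero]⟩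

theorem mul_eq_zero_of_wittReduce_eq_zero [CharP k p] (x y : TruncatedWittVector p 2 k)
    (hx : wittReduce p k x = 0) (hy : wittReduce p k y = 0) : x * y = 0 := by
  obtain ⟨x, rfl⟩ := WittVector.truncate_surjective p 2 k x
  obtain ⟨y, rfl⟩ := WittVector.truncate_surjective p 2 k y
  rw [wittReduce_truncate] at hx hy
  have hV : ∀ z : WittVector p k, z.coeff 0 = 0 → ∀ i < 1, z.coeff i = 0 := fun z hz i hi => by
    rwa [Nat.lt_one_iff.mp hi]
  rw [← map_mul, ← RingHom.mem_ker, WittVector.mem_ker_truncate,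
    WittVector.eq_iterate_verschiebung (hV x hx), WittVector.eq_iterate_verschiebung (hV y hy),
    WittVector.iterate_verschiebung_mul]
  exact fun i hi => WittVector.iterate_verschiebung_coeff_eq_zero _ hi

end WittReduction

theorem RingHom.mapMatrix_mul_eq_zero {A B ι : Type*} [Ring A] [Ring B] [Fintype ι]
    [DecidableEq ι] {φ : A →+* B} (hker : ∀ x y, φ x = 0 → φ y = 0 → x * y = 0)
    (x y : Matrix ι ι A) (hx : φ.mapMatrix x = 0) (hy : φ.mapMatrix y = 0) : x * y = 0 := by
  ext i j
  rw [Matrix.mul_apply, Matrix.zero_apply]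
  exact Finset.sum_eq_zero fun l _ =>
    hker _ _ (congrFun (congrFun hx i) l) (congrFun (congrFun hy l) j)

theorem hasLp_iff_matrix (p : ℕ) [Fact p.Prime] (G : Type*) [Group G] :
    HasLp p G ↔ ∀ (n : ℕ), 1 ≤ n → ∀ (k : Type) [Field k] [Fintype k] [CharP k p],
      ∀ f : G →* Matrix (Fin n) (Fin n) k,
        ∃ g : G →* Matrix (Fin n) (Fin n) (TruncatedWittVector p 2 k),
          ∀ x, (wittReduce p k).mapMatrix (g x) = f x := by
  refine ⟨fun h n hn k _ _ _ f => ?_, fun h n hn k _ _ _ f => ?_⟩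
  · obtain ⟨g, hg⟩ := h n hn k f.toHomUnits
    refine ⟨(Units.coeHom _).comp g, fun x => ?_⟩
    exact congrArg Units.val (DFunLike.congr_fun hg x)
  · obtain ⟨g, hg⟩ := h n hn k ((Units.coeHom _).comp f)
    refine ⟨g.toHomUnits, ?_⟩
    ext1 x
    exact Units.ext (hg x)

theorem HasLp.exists_matrix_lift {p : ℕ} [Fact p.Prime] {G : Type*} [Group G] (h : HasLp p G)
    {ι : Type*} [Fintype ι] [DecidableEq ι] [Nonempty ι] (k : Type) [Field k] [Fintype k]
    [CharP k p] (f : G →* Matrix ι ι k) :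
    ∃ g : G →* Matrix ι ι (TruncatedWittVector p 2 k),
      ∀ x, (wittReduce p k).mapMatrix (g x) = f x := by
  let e := Fintype.equivFin ι
  obtain ⟨g, hg⟩ := (hasLp_iff_matrix p G).mp h (Fintype.card ι) Fintype.card_pos k
    ((Matrix.reindexAlgEquiv k k e : _ →* _).comp f)
  refine ⟨(Matrix.reindexAlgEquiv ℤ (TruncatedWittVector p 2 k) e.symm : _ →* _).comp g,
    fun x => ?_⟩
  ext i j
  simpa using congrFun (congrFun (hg x) (e i)) (e j)

theorem HasLp.of_subgroup {p : ℕ} [Fact p.Prime] {G : Type*} [Group G] {H : Subgroup G}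
    [H.FiniteIndex] (hindex : ¬ p ∣ H.index) (h : HasLp p H) : HasLp p G := by
  rw [hasLp_iff_matrix] at h ⊢
  intro n hn k _ _ _ f
  obtain ⟨g, hg⟩ := h n hn k (f.comp H.subtype)
  have hunit : IsUnit (H.index : k) := by
    rwa [isUnit_iff_ne_zero, Ne, CharP.cast_eq_zero_iff k p]
  refine exists_monoidHom_lift_of_subgroup H (φ := (wittReduce p k).mapMatrix)
    (fun b => ⟨b.map (Function.surjInv (wittReduce_surjective p k)), by
      ext i j
      exact Function.surjInv_eq (wittReduce_surjective p k) (b i j)⟩)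
    (RingHom.mapMatrix_mul_eq_zero (mul_eq_zero_of_wittReduce_eq_zero p k)) ?_ f g hg
  simpa using hunit.map (algebraMap k (Matrix (Fin n) (Fin n) k))

theorem HasLp.subgroup {p : ℕ} [Fact p.Prime] {G : Type*} [Group G] (h : HasLp p G)
    (H : Subgroup G) [H.FiniteIndex] : HasLp p H := by
  classical
  rw [hasLp_iff_matrix]
  intro n hn k _ _ _ f
  let := Fintype.ofFinite (G ⧸ H)
  have : Nonempty (Fin n) := ⟨⟨0, hn⟩⟩
  obtain ⟨F, hF⟩ := h.exists_matrix_lift k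
    ((Matrix.compRingEquiv (G ⧸ H) (Fin n) k).toMonoidHom.comp (H.inducedMatrix f))
  refine Subgroup.exists_lift_of_inducedMatrix_lift (φ := (wittReduce p k).mapMatrix)
    (RingHom.mapMatrix_mul_eq_zero (mul_eq_zero_of_wittReduce_eq_zero p k)) f
    ((Matrix.compRingEquiv (G ⧸ H) (Fin n) _).symm.toMonoidHom.comp F) fun x => ?_
  ext a b i j
  exact congrFun (congrFun (hF x) (a, i)) (b, j)

/-- `G` has property `L_p` iff a Sylow `p`-subgroup has property `L_p`. -/
theorem sylow_hasLp_iff (p : ℕ) [Fact p.Prime] (G : Type*) [Group G] [Finite G]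
    (P : Sylow p G) : HasLp p G ↔ HasLp p ↥(P : Subgroup G) := by
  exact ⟨fun h => h.subgroup _, HasLp.of_subgroup P.not_dvd_index⟩
end

section
/- Let k be a field of characteristic 3, let A be a commutative local ring, and let φ : A → k be a surjective ring homomorphism. Then for every n ≥ 1, every element x ∈ GL_n(k) with x³ = 1 lifts to an element X ∈ GL_n(A) with X³ = 1; that is, applying φ entrywise to X gives x. -/
namespace CubeRootLift

open Polynomial
open scoped DirectSum

/-- An integer matrix of cube `1` whose reduction mod `3` is, for `d ≤ 3`, conjugate to a
unipotent Jordan block. -/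
def cubeRootBlock : (d : ℕ) → Matrix (Fin d) (Fin d) ℤ
  | 2 => !![0, -1; 1, -1]
  | 3 => !![0, 0, 1; 1, 0, 0; 0, 1, 0]
  | _ => 1

theorem cubeRootBlock_pow_three (d : ℕ) : cubeRootBlock d ^ 3 = 1 := by
  match d with
  | 0 => simp [cubeRootBlock]
  | 1 => simp [cubeRootBlock]
  | 2 => decide
  | 3 => decide
  | d + 4 => simp [cubeRootBlock]

theorem exists_basis_adjoinRoot {k : Type*} [Field k] [CharP k 3] {d : ℕ} (hd : d ≤ 3) :
    ∃ b : Module.Basis (Fin d) k (AdjoinRoot ((X - C 1 : k[X]) ^ d)),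
      ∀ j, AdjoinRoot.root ((X - C 1 : k[X]) ^ d) * b j =
        ∑ i, (cubeRootBlock d i j : k) • b i := by
  have hm : ((X - C 1 : k[X]) ^ d).Monic := (monic_X_sub_C 1).pow d
  have hn : ((X - C 1 : k[X]) ^ d).natDegree = d := by
    rw [natDegree_pow, natDegree_X_sub_C, mul_one]
  let P := AdjoinRoot.powerBasis' hm
  refine ⟨P.basis.reindex (finCongr hn), ?_⟩
  have hb : ∀ j, P.basis.reindex (finCongr hn) j =
      (AdjoinRoot.root ((X - C 1 : k[X]) ^ d)) ^ (j : ℕ) := by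
    intro j
    simp only [Module.Basis.reindex_apply, PowerBasis.basis_eq_pow]
    rfl
  have hr : (AdjoinRoot.root ((X - C 1 : k[X]) ^ d) - 1) ^ d = 0 := by
    have := AdjoinRoot.mk_self (f := ((X - C 1 : k[X]) ^ d))
    simpa [-AdjoinRoot.mk_self] using this
  have h3 : (3 : AdjoinRoot ((X - C 1 : k[X]) ^ d)) = 0 := by
    have := congrArg (algebraMap k (AdjoinRoot ((X - C 1 : k[X]) ^ d))) (CharP.cast_eq_zero k 3)
    rwa [map_natCast, map_zero, Nat.cast_ofNat] at this
  simp only [hb]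
  generalize AdjoinRoot.root ((X - C 1 : k[X]) ^ d) = r at *
  clear hb P hn
  interval_cases d
  · intro j; exact j.elim0
  · intro j
    simp only [Finset.univ_unique, Fin.default_eq_zero, Finset.sum_singleton, Subsingleton.elim j 0]
    simp [cubeRootBlock]
    linear_combination hr
  · intro j
    fin_cases j <;> simp [Fin.sum_univ_succ, cubeRootBlock]
    linear_combination hr + r * h3
  · intro j
    fin_cases j <;> simp [Fin.sum_univ_succ, cubeRootBlock]
    · ring
    · linear_combination hr + (r ^ 2 - r) * h3

theorem exists_basis_quotient {k : Type*} [Field k] [CharP k 3] {d : ℕ} (hd : d ≤ 3) :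
    ∃ b : Module.Basis (Fin d) k (k[X] ⧸ k[X] ∙ (X - C 1 : k[X]) ^ d),
      ∀ j, (X : k[X]) • b j = ∑ i, (cubeRootBlock d i j : k) • b i :=
  exists_basis_adjoinRoot hd

theorem basis_dfinsupp_apply {ι R : Type*} [DecidableEq ι] [Semiring R] {M : ι → Type*}
    [∀ i, AddCommMonoid (M i)] [∀ i, Module R (M i)] {η : ι → Type*}
    (b : ∀ i, Module.Basis (η i) R (M i)) (i : ι) (j : η i) :
    DFinsupp.basis b ⟨i, j⟩ = DFinsupp.single i (b i j) := by
  classical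
  apply (DFinsupp.basis b).repr.injective
  rw [Module.Basis.repr_self]
  simp only [DFinsupp.basis, LinearEquiv.trans_apply]
  rw [LinearEquiv.eq_symm_apply]
  simp

theorem exists_basis_of_pow_smul_eq_zero {k M : Type*} [Field k] [CharP k 3] [AddCommGroup M]
    [Module k M] [Module k[X] M] [IsScalarTower k k[X] M] [Module.Finite k[X] M]
    (hM : ∀ m : M, (X - C 1 : k[X]) ^ 3 • m = 0) :
    ∃ (ι : Type) (_ : Fintype ι) (_ : DecidableEq ι) (J : Matrix ι ι ℤ) (b : Module.Basis ι k M),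
      J ^ 3 = 1 ∧ ∀ j, (X : k[X]) • b j = ∑ i, (J i j : k) • b i := by
  obtain ⟨s, e, ⟨f⟩⟩ := Module.torsion_by_prime_power_decomposition (R := k[X]) (M := M)
    (p := X - C 1) (irreducible_X_sub_C 1) (fun {m} => ⟨⟨_, 3, rfl⟩, hM m⟩)
  have he : ∀ i, e i ≤ 3 := by
    intro i
    have h1 : (X - C 1 : k[X]) ^ 3 • DirectSum.lof k[X] (Fin s)
        (fun i => k[X] ⧸ k[X] ∙ (X - C 1 : k[X]) ^ e i) i (Submodule.Quotient.mk 1) = 0 := by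
      apply f.symm.injective
      rw [map_smul, hM, map_zero]
    rw [← map_smul, ← Submodule.Quotient.mk_smul] at h1
    have h2 := DFinsupp.single_injective (h1.trans (DFinsupp.single_zero i).symm)
    rw [Submodule.Quotient.mk_eq_zero, Submodule.mem_span_singleton, smul_eq_mul, mul_one] at h2
    obtain ⟨a, ha⟩ := h2
    exact (pow_dvd_pow_iff (irreducible_X_sub_C 1).ne_zero (irreducible_X_sub_C 1).not_isUnit).1
      ⟨a, by rw [← ha, smul_eq_mul, mul_comm]⟩
  choose B hB using fun i => exists_basis_quotient (k := k) (he i)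
  refine ⟨Σ i, Fin (e i), inferInstance, inferInstance,
    Matrix.blockDiagonal' fun i => cubeRootBlock (e i),
    (DFinsupp.basis B).map (f.restrictScalars k).symm, ?_, ?_⟩
  · refine (Matrix.blockDiagonal'_pow _ 3).symm.trans ?_
    simp only [Pi.pow_def, cubeRootBlock_pow_three]
    exact Matrix.blockDiagonal'_one
  · rintro ⟨i, j⟩
    have key : (X : k[X]) • (DFinsupp.basis B ⟨i, j⟩ : ⨁ i, k[X] ⧸ k[X] ∙ (X - C 1 : k[X]) ^ e i) =
        ∑ l, ((Matrix.blockDiagonal' (fun i => cubeRootBlock (e i)) l ⟨i, j⟩ : ℤ) : k) •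
          DFinsupp.basis B l := by
      rw [Fintype.sum_sigma, Finset.sum_eq_single i]
      · simp only [Matrix.blockDiagonal'_apply_eq]
        rw [basis_dfinsupp_apply]
        refine (map_smul (DirectSum.lof k[X] (Fin s)
          (fun i => k[X] ⧸ k[X] ∙ (X - C 1 : k[X]) ^ e i) i) X (B i j)).symm.trans ?_
        rw [hB, map_sum]
        refine Finset.sum_congr rfl fun l _ => ?_
        rw [basis_dfinsupp_apply]
        exact DFinsupp.single_smul _ _
      · intro l _ hl
        refine Finset.sum_eq_zero fun t _ => ?_
        rw [Matrix.blockDiagonal'_apply_ne _ _ _ hl, Int.cast_zero, zero_smul]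
      · simp
    have := congrArg f.symm key
    rw [map_smul, map_sum] at this
    refine this.trans (Finset.sum_congr rfl fun l _ => ?_)
    exact (f.restrictScalars k).symm.map_smul _ _

theorem exists_conj_int {k : Type*} [Field k] [CharP k 3] {n : ℕ} (x : Matrix (Fin n) (Fin n) k)
    (hx : x ^ 3 = 1) :
    ∃ (J : Matrix (Fin n) (Fin n) ℤ) (P : Matrix (Fin n) (Fin n) k),
      J ^ 3 = 1 ∧ IsUnit P.det ∧ x * P = P * J.map (Int.cast) := by
  have h0 : (x - 1) ^ 3 = 0 := by
    have h3 : (3 : Matrix (Fin n) (Fin n) k) = 0 := by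
      have := congrArg (algebraMap k (Matrix (Fin n) (Fin n) k)) (CharP.cast_eq_zero k 3)
      rwa [map_natCast, map_zero, Nat.cast_ofNat] at this
    have : (x - 1) ^ 3 = x ^ 3 - 1 - 3 * (x ^ 2 - x) := by noncomm_ring
    rw [this, hx, h3]
    simp
  obtain ⟨ι, _, _, J, b, hJ, hb⟩ := exists_basis_of_pow_smul_eq_zero (k := k)
    (M := Module.AEval' (Matrix.toLin' x)) (by
      intro m
      apply (Module.AEval'.of (Matrix.toLin' x)).symm.injective
      rw [Module.AEval.of_symm_smul]
      have : aeval (Matrix.toLin' x) ((X - C 1 : k[X]) ^ 3) = Matrix.toLin' ((x - 1) ^ 3) := by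
        simp [Matrix.toLin'_pow, Module.End.one_eq_id]
      rw [this, h0]
      simp)
  let c : Module.Basis ι k (Fin n → k) := b.map (Module.AEval'.of (Matrix.toLin' x)).symm
  have hc : ∀ j, x.mulVec (c j) = ∑ i, (J i j : k) • c i := by
    intro j
    have := congrArg (Module.AEval'.of (Matrix.toLin' x)).symm (hb j)
    rw [Module.AEval'.of_symm_X_smul, map_sum] at this
    simpa [c] using this
  let e : ι ≃ Fin n := c.indexEquiv (Pi.basisFun k (Fin n))
  refine ⟨J.reindex e e, (Pi.basisFun k (Fin n)).toMatrix (c.reindex e), ?_, ?_, ?_⟩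
  · have := map_pow (Matrix.reindexAlgEquiv ℤ ℤ e) J 3
    rw [hJ, map_one] at this
    exact this.symm
  · have := (Pi.basisFun k (Fin n)).invertibleToMatrix (c.reindex e)
    exact Matrix.isUnit_det_of_invertible _
  · ext i j
    have := congrFun (hc (e.symm j)) i
    simp only [Matrix.mul_apply, Module.Basis.toMatrix_apply, Pi.basisFun_repr,
      Module.Basis.reindex_apply, Matrix.map_apply, Matrix.reindex_apply, Matrix.submatrix_apply]
    rw [Matrix.mulVec, dotProduct, Finset.sum_apply] at this
    rw [this, ← e.symm.sum_comp]
    refine Finset.sum_congr rfl fun l _ => ?_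
    simp only [Pi.smul_apply, smul_eq_mul]
    exact mul_comm _ _

end CubeRootLift


/-- over a field `k` of characteristic `3`, every `x ∈ GL_n(k)` with `x³ = 1`
lifts, along any surjection `A → k` from a commutative local ring, to an `X ∈ GL_n(A)`
with `X³ = 1`. -/
theorem lift_of_cube_eq_one (k : Type*) [Field k] [CharP k 3]
    (A : Type*) [CommRing A] [IsLocalRing A] (φ : A →+* k) (hφ : Function.Surjective φ) :
    ∀ n : ℕ, 1 ≤ n → ∀ x : GL (Fin n) k, x ^ 3 = 1 →
      ∃ X : GL (Fin n) A, X ^ 3 = 1 ∧ Matrix.GeneralLinearGroup.map φ X = x := by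
  intro n _ x hx
  obtain ⟨J, P, hJ, hP, hxP⟩ := CubeRootLift.exists_conj_int x.val
    (by rw [← Units.val_pow_eq_pow_val, hx, Units.val_one])
  have : IsLocalHom φ := .of_surjective φ hφ
  obtain ⟨Q, hQ⟩ : ∃ Q : Matrix (Fin n) (Fin n) A, Q.map φ = P :=
    ⟨P.map (Function.surjInv hφ), by ext; simp [Function.surjInv_eq]⟩
  have hQu : IsUnit Q.det := by
    apply isUnit_of_map_unit φ
    rwa [RingHom.map_det, RingHom.mapMatrix_apply, hQ]
  let q : GL (Fin n) A := Matrix.GeneralLinearGroup.mk'' Q hQu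
  let j : GL (Fin n) ℤ := Units.ofPowEqOne J 3 hJ (by norm_num)
  have hj : j ^ 3 = 1 := Units.pow_ofPowEqOne hJ _
  let jA := Matrix.GeneralLinearGroup.map (Int.castRingHom A) j
  refine ⟨q * jA * q⁻¹, ?_, ?_⟩
  · rw [conj_pow, ← map_pow, hj]
    simp
  · rw [map_mul, map_mul, map_inv, mul_inv_eq_iff_eq_mul]
    apply Units.ext
    have h1 : (Matrix.GeneralLinearGroup.map φ q : Matrix (Fin n) (Fin n) k) = P := hQ
    have h2 : (Matrix.GeneralLinearGroup.map φ jA : Matrix (Fin n) (Fin n) k) = J.map Int.cast := by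
      ext a b
      exact map_intCast φ (J a b)
    rw [Units.val_mul, Units.val_mul, h1, h2, hxP]
end

section
/- Let k be a field of characteristic 2, let n ≥ 0, let A be a commutative local ring, and let φ : A → k be a surjective ring homomorphism. Then for every m ≥ 1, every element x ∈ GL_m(k) of order 2^n lifts to an element X ∈ GL_m(A) of order 2^n; that is, applying φ entrywise to X gives x, and X has order 2^n. -/
open Polynomial in
theorem exists_monic_natDegree_eq_dvd_X_pow_two_pow_sub_one (n : ℕ) :
    ∀ d ≤ 2 ^ n, ∃ f : ℤ[X], f.Monic ∧ f.natDegree = d ∧ f ∣ X ^ 2 ^ n - 1 := by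
  induction n with
  | zero =>
    intro d hd
    rcases Nat.le_one_iff_eq_zero_or_eq_one.mp (by simpa using hd) with rfl | rfl
    · exact ⟨1, monic_one, natDegree_one, one_dvd _⟩
    · exact ⟨X - C 1, monic_X_sub_C 1, natDegree_X_sub_C 1, by simp⟩
  | succ n ih =>
    intro d hd
    have hfac : (X ^ 2 ^ (n + 1) - 1 : ℤ[X]) = (X ^ 2 ^ n - 1) * (X ^ 2 ^ n + C 1) := by
      rw [pow_succ, pow_mul, C_1]; ring
    rw [hfac]
    by_cases h : d ≤ 2 ^ n
    · obtain ⟨f, hf, hfd, hdvd⟩ := ih d h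
      exact ⟨f, hf, hfd, hdvd.mul_right _⟩
    · obtain ⟨f, hf, hfd, hdvd⟩ := ih (d - 2 ^ n) (by rw [pow_succ] at hd; omega)
      have hm : (X ^ 2 ^ n + C 1 : ℤ[X]).Monic := monic_X_pow_add_C 1 (by positivity)
      refine ⟨f * (X ^ 2 ^ n + C 1), hf.mul hm, ?_, mul_dvd_mul_right hdvd _⟩
      rw [hf.natDegree_mul hm, hfd, natDegree_X_pow_add_C]
      omega

open Polynomial in
theorem X_pow_two_pow_sub_one_eq (k : Type*) [Field k] [CharP k 2] (n : ℕ) :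
    (X ^ 2 ^ n - 1 : k[X]) = (X - C 1) ^ 2 ^ n := by
  rw [sub_pow_char_pow, C_1, one_pow]

open Polynomial in
theorem map_eq_X_sub_one_pow {k : Type*} [Field k] [CharP k 2] {n : ℕ} {f : ℤ[X]}
    (hf : f.Monic) (hdvd : f ∣ X ^ 2 ^ n - 1) :
    f.map (Int.castRingHom k) = (X - C 1) ^ f.natDegree := by
  have h : f.map (Int.castRingHom k) ∣ (X - C 1) ^ 2 ^ n := by
    rw [← X_pow_two_pow_sub_one_eq]
    simpa using Polynomial.map_dvd (Int.castRingHom k) hdvd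
  obtain ⟨j, -, hj⟩ := (dvd_prime_pow (prime_X_sub_C (1 : k)) _).mp h
  have hj' := eq_of_monic_of_associated (hf.map _) ((monic_X_sub_C 1).pow j) hj
  have hd := congrArg natDegree hj'
  rw [hf.natDegree_map, natDegree_pow, natDegree_X_sub_C, mul_one] at hd
  rw [hj', hd]

open Polynomial in
/-- The matrix of multiplication by the root of a monic polynomial `g` of degree `d`
in the power basis of `AdjoinRoot g`. -/
noncomputable def companionMatrix {R : Type*} [CommRing R] (g : R[X]) (d : ℕ) :
    Matrix (Fin d) (Fin d) R :=
  Matrix.of fun i j => (X ^ (j.val + 1) %ₘ g).coeff i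

open Polynomial in
theorem companionMatrix_map {R S : Type*} [CommRing R] [CommRing S] (φ : R →+* S) {g : R[X]}
    (hg : g.Monic) (d : ℕ) :
    (companionMatrix g d).map φ = companionMatrix (g.map φ) d := by
  ext i j
  simp only [companionMatrix, Matrix.map_apply, Matrix.of_apply]
  rw [← coeff_map, map_modByMonic φ hg, Polynomial.map_pow, map_X]

open Polynomial in
theorem exists_basis_leftMulMatrix_root_eq_companionMatrix {R : Type*} [CommRing R] {g : R[X]}
    (hg : g.Monic) {d : ℕ} (hd : g.natDegree = d) :
    ∃ b : Module.Basis (Fin d) R (AdjoinRoot g),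
      Algebra.leftMulMatrix b (AdjoinRoot.root g) = companionMatrix g d := by
  subst hd
  refine ⟨AdjoinRoot.powerBasisAux' hg, ?_⟩
  ext i j
  have h : AdjoinRoot.powerBasisAux' hg j = AdjoinRoot.root g ^ j.val := by
    exact (AdjoinRoot.powerBasis' hg).basis_eq_pow j
  rw [Algebra.leftMulMatrix_eq_repr_mul, h, AdjoinRoot.powerBasisAux'_repr_apply_to_fun,
    ← pow_succ', ← AdjoinRoot.mk_X, ← map_pow, AdjoinRoot.modByMonicHom_mk]
  rfl

open Polynomial in
theorem companionMatrix_pow_eq_one {R : Type*} [CommRing R] {g : R[X]}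
    (hg : g.Monic) {d N : ℕ} (hd : g.natDegree = d) (hdvd : g ∣ X ^ N - 1) :
    companionMatrix g d ^ N = 1 := by
  obtain ⟨b, hb⟩ := exists_basis_leftMulMatrix_root_eq_companionMatrix hg hd
  have h : AdjoinRoot.root g ^ N = 1 := by
    have := AdjoinRoot.mk_eq_zero.mpr hdvd
    simpa [sub_eq_zero] using this
  rw [← hb, ← map_pow, h, map_one]

open Polynomial in
theorem exists_linearEquiv_pi_adjoinRoot {k V : Type*} [Field k] [AddCommGroup V] [Module k V]
    [FiniteDimensional k V] (T : V →ₗ[k] V) (N : ℕ) (hT : aeval T ((X - C 1 : k[X]) ^ N) = 0) :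
    ∃ (r : ℕ) (e : Fin r → ℕ) (ψ : V ≃ₗ[k] Π i, AdjoinRoot ((X - C 1 : k[X]) ^ e i)),
      (∀ i, e i ≤ N) ∧ ∀ v i, ψ (T v) i = AdjoinRoot.root _ * ψ v i := by
  have htors : Module.IsTorsion' (Module.AEval' T) (Submonoid.powers (X - C 1 : k[X])) := by
    intro v
    refine ⟨⟨(X - C 1) ^ N, N, rfl⟩, ?_⟩
    apply (Module.AEval.of k V T).symm.injective
    change (aeval T ((X - C 1 : k[X]) ^ N)) _ = _
    rw [hT]
    exact LinearMap.zero_apply _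
  obtain ⟨r, e, ⟨E⟩⟩ := Module.torsion_by_prime_power_decomposition
    (prime_X_sub_C (1 : k)).irreducible htors
  let E' := E.trans (DirectSum.linearEquivFunOnFintype k[X] (Fin r)
    (fun i => k[X] ⧸ Submodule.span k[X] {(X - C 1 : k[X]) ^ e i}))
  have hE : ∀ (p : k[X]) (v : V) i, E' (Module.AEval'.of T (aeval T p v)) i
      = p • E' (Module.AEval'.of T v) i := by
    intro p v i
    have := Module.AEval.of_aeval_smul (R := k) (M := V) T p v
    change E' (Module.AEval.of k V T (aeval T p • v)) i = _
    rw [this, map_smul]; rfl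
  refine ⟨r, e, (Module.AEval'.of T).trans (E'.restrictScalars k), fun i => ?_, fun v i => ?_⟩
  · obtain ⟨v, hv⟩ := ((Module.AEval'.of T).toEquiv.trans E'.toEquiv).surjective
      (Pi.single i (Submodule.Quotient.mk 1))
    have h := hE ((X - C 1) ^ N) v i
    replace hv : E' (Module.AEval'.of T v) = _ := hv
    rw [hT, hv, Pi.single_eq_same, ← Submodule.Quotient.mk_smul, LinearMap.zero_apply, map_zero,
      map_zero, Pi.zero_apply, eq_comm, Submodule.Quotient.mk_eq_zero, smul_eq_mul, mul_one,
      Submodule.mem_span_singleton] at h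
    obtain ⟨q, hq⟩ := h
    exact (pow_dvd_pow_iff (prime_X_sub_C (1 : k)).ne_zero (prime_X_sub_C (1 : k)).not_isUnit).mp
      ⟨q, by rw [← hq, smul_eq_mul, mul_comm]⟩
  · have h := hE X v i
    rw [aeval_X] at h
    obtain ⟨q, hq⟩ := Submodule.Quotient.mk_surjective _ (E' (Module.AEval'.of T v) i)
    rw [← hq] at h
    change E' (Module.AEval'.of T (T v)) i = _ * E' (Module.AEval'.of T v) i
    rw [h, ← hq]
    rfl

open Polynomial in
theorem exists_basis_toMatrix_eq_blockDiagonal' {k V : Type*} [Field k] [AddCommGroup V]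
    [Module k V] [FiniteDimensional k V] (T : V →ₗ[k] V) (N : ℕ)
    (hT : aeval T ((X - C 1 : k[X]) ^ N) = 0) :
    ∃ (r : ℕ) (e : Fin r → ℕ) (b : Module.Basis (Σ i, Fin (e i)) k V), (∀ i, e i ≤ N) ∧
      LinearMap.toMatrix b b T =
        Matrix.blockDiagonal' fun i => companionMatrix ((X - C 1 : k[X]) ^ e i) (e i) := by
  obtain ⟨r, e, ψ, he, hψ⟩ := exists_linearEquiv_pi_adjoinRoot T N hT
  choose b hb using fun i => exists_basis_leftMulMatrix_root_eq_companionMatrix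
    ((monic_X_sub_C (1 : k)).pow (e i)) (d := e i)
      (by rw [natDegree_pow, natDegree_X_sub_C, mul_one])
  refine ⟨r, e, (Pi.basis b).map ψ.symm, he, ?_⟩
  ext ⟨i, s⟩ ⟨j, t⟩
  have h : ψ (T (ψ.symm (Pi.basis b ⟨j, t⟩))) = Pi.single j (AdjoinRoot.root _ * b j t) := by
    ext l
    rw [hψ, LinearEquiv.apply_symm_apply, Pi.basis_apply]
    rcases eq_or_ne l j with rfl | hl
    · simp
    · simp [hl]
  rw [LinearMap.toMatrix_apply, Module.Basis.map_repr, Module.Basis.map_apply,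
    LinearEquiv.trans_apply, LinearEquiv.symm_symm, h, Pi.basis_repr]
  rcases eq_or_ne i j with rfl | hij
  · rw [Matrix.blockDiagonal'_apply_eq, ← hb, Algebra.leftMulMatrix_eq_repr_mul, Pi.single_eq_same]
  · rw [Matrix.blockDiagonal'_apply_ne _ _ _ hij, Pi.single_eq_of_ne hij]
    simp

theorem Matrix.GeneralLinearGroup.map_surjective {n A k : Type*} [Fintype n] [DecidableEq n]
    [CommRing A] [CommRing k] (φ : A →+* k) [IsLocalHom φ] (hφ : Function.Surjective φ) :
    Function.Surjective (Matrix.GeneralLinearGroup.map (n := n) φ) := by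
  intro P
  choose Q hQ using fun i j => hφ (P i j)
  have hmap : φ.mapMatrix (Matrix.of Q) = P.val := by
    ext i j
    simp [hQ]
  have hdet : IsUnit (Matrix.of Q).det := by
    apply IsUnit.of_map φ
    rw [RingHom.map_det, hmap]
    exact (Matrix.isUnit_iff_isUnit_det _).mp P.isUnit
  exact ⟨Matrix.GeneralLinearGroup.mk'' _ hdet, Units.ext hmap⟩

/-- over a field `k` of characteristic `2`, every element of `GL_m(k)` of
order `2^n` lifts, along any surjection `A → k` from a commutative local ring, to an
element of `GL_m(A)` of order `2^n`. -/
theorem lift_of_two_power_order (k : Type*) [Field k] [CharP k 2] (n : ℕ)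
    (A : Type*) [CommRing A] [IsLocalRing A] (φ : A →+* k) (hφ : Function.Surjective φ) :
    ∀ m : ℕ, 1 ≤ m → ∀ x : GL (Fin m) k, orderOf x = 2 ^ n →
      ∃ X : GL (Fin m) A, Matrix.GeneralLinearGroup.map φ X = x ∧ orderOf X = 2 ^ n := by
  intro m _ x hx
  have hxpow : x.val ^ 2 ^ n = 1 := by
    rw [← Units.val_pow_eq_pow_val, ← hx, pow_orderOf_eq_one, Units.val_one]
  have hT : Polynomial.aeval (Matrix.toLin' x.val)
      ((Polynomial.X - Polynomial.C 1 : Polynomial k) ^ 2 ^ n) = 0 := by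
    rw [← X_pow_two_pow_sub_one_eq, map_sub, map_pow, Polynomial.aeval_X, map_one,
      ← Matrix.toLin'_pow, hxpow, Matrix.toLin'_one]
    exact sub_self _
  obtain ⟨r, e, b, he, hb⟩ := exists_basis_toMatrix_eq_blockDiagonal' _ _ hT
  choose f hf hfd hfdvd using
    fun i => exists_monic_natDegree_eq_dvd_X_pow_two_pow_sub_one n (e i) (he i)
  let D : Matrix (Σ i, Fin (e i)) (Σ i, Fin (e i)) ℤ :=
    Matrix.blockDiagonal' fun i => companionMatrix (f i) (e i)
  have hD : D ^ 2 ^ n = 1 := by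
    rw [← Matrix.blockDiagonal'_pow, ← Matrix.blockDiagonal'_one]
    congr 1
    ext1 i
    exact companionMatrix_pow_eq_one (hf i) (hfd i) (hfdvd i)
  have hDk : D.map (Int.castRingHom k) = LinearMap.toMatrix b b (Matrix.toLin' x.val) := by
    rw [hb, Matrix.blockDiagonal'_map _ _ (map_zero _)]
    congr 1
    ext1 i
    rw [companionMatrix_map _ (hf i), map_eq_X_sub_one_pow (hf i) (hfdvd i), hfd]
  let σ : (Σ i, Fin (e i)) ≃ Fin m := b.indexEquiv (Pi.basisFun k (Fin m))
  let c := b.reindex σ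
  let D' : Matrix (Fin m) (Fin m) ℤ := Matrix.reindexAlgEquiv ℤ ℤ σ D
  have hD' : D' ^ 2 ^ n = 1 := by rw [← map_pow, hD, map_one]
  let u : GL (Fin m) ℤ := Units.ofPowEqOne D' (2 ^ n) hD' (by positivity)
  have hu : u ^ 2 ^ n = 1 := Units.ext hD'
  have huk : (Int.castRingHom k).mapMatrix D' = LinearMap.toMatrix c c (Matrix.toLin' x.val) := by
    ext i j
    have := congrFun₂ hDk (σ.symm i) (σ.symm j)
    simpa [D', c, LinearMap.toMatrix_apply] using this
  let P : GL (Fin m) k :=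
    ⟨(Pi.basisFun k (Fin m)).toMatrix c, c.toMatrix (Pi.basisFun k (Fin m)),
      Module.Basis.toMatrix_mul_toMatrix_flip _ _, Module.Basis.toMatrix_mul_toMatrix_flip _ _⟩
  have hP : P * Matrix.GeneralLinearGroup.map (Int.castRingHom k) u * P⁻¹ = x := by
    apply Units.ext
    change (Pi.basisFun k (Fin m)).toMatrix c * (Int.castRingHom k).mapMatrix D' *
      c.toMatrix (Pi.basisFun k (Fin m)) = x.val
    rw [huk, basis_toMatrix_mul_linearMap_toMatrix_mul_basis_toMatrix]
    exact LinearMap.toMatrix'_toLin' _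
  have : IsLocalHom φ := hφ.isLocalHom
  obtain ⟨Q, hQ⟩ := Matrix.GeneralLinearGroup.map_surjective φ hφ P
  let Y : GL (Fin m) A := Q * Matrix.GeneralLinearGroup.map (Int.castRingHom A) u * Q⁻¹
  have hY : Matrix.GeneralLinearGroup.map φ Y = x := by
    rw [map_mul, map_mul, map_inv, hQ, ← hP, ← MonoidHom.comp_apply,
      ← Matrix.GeneralLinearGroup.map_comp]
    congr!
    exact RingHom.ext_int _ _
  refine ⟨Y, hY, Nat.dvd_antisymm (orderOf_dvd_of_pow_eq_one ?_) ?_⟩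
  · rw [conj_pow, ← map_pow, hu, map_one, mul_one, mul_inv_cancel]
  · rw [← hx, ← hY]
    exact orderOf_map_dvd _ _
end

section
/- Let p be a prime and n a positive integer such that either p ≥ 3 and n ≥ 2, or p ≥ 5 and n ≥ 1. Set m = p^{n-1} + 1, and let x ∈ M_m(𝔽_p) be the unipotent Jordan block of size m (the m×m matrix with 1's on the diagonal and on the superdiagonal and 0 elsewhere); x is invertible and x^{p^n} = 1. Then for every matrix X ∈ M_m(ℤ/p²ℤ) whose entrywise reduction modulo p equals x, one has X^{p^n} ≠ 1. -/
/-- The unipotent Jordan block of size `m`: ones on the diagonal and superdiagonal,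
zeros elsewhere. -/
def unipotentJordanBlock (R : Type*) [CommRing R] (m : ℕ) : Matrix (Fin m) (Fin m) R :=
  Matrix.of fun i j => if (i : ℕ) = (j : ℕ) then 1 else if (i : ℕ) + 1 = (j : ℕ) then 1 else 0

theorem unipotentJordanBlock_sub_one_pow_apply {R : Type*} [CommRing R] {m : ℕ} (k : ℕ)
    (i j : Fin m) :
    ((unipotentJordanBlock R m - 1) ^ k) i j = if (i : ℕ) + k = j then 1 else 0 := by
  induction k generalizing i with
  | zero => simp [Matrix.one_apply, Fin.ext_iff]
  | succ k ih =>
    have hS (l : Fin m) : (unipotentJordanBlock R m - 1) i l =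
        if (i : ℕ) + 1 = l then 1 else 0 := by
      rw [Matrix.sub_apply, Matrix.one_apply, unipotentJordanBlock, Matrix.of_apply]
      simp only [Fin.ext_iff]
      split_ifs <;> first | omega | simp
    rw [pow_succ', Matrix.mul_apply]
    simp only [hS, ih, ite_mul, one_mul, zero_mul]
    by_cases hi : (i : ℕ) + 1 < m
    · rw [Finset.sum_eq_single ⟨i + 1, hi⟩]
      · simp [add_assoc, add_comm 1 k]
      · intro b _ hb
        rw [if_neg]
        intro h
        exact hb (Fin.ext h.symm)
      · simp
    · rw [if_neg (by omega)]
      refine Finset.sum_eq_zero fun l _ => ?_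
      rw [if_neg (by omega)]

theorem unipotentJordanBlock_sub_one_pow_eq_zero {R : Type*} [CommRing R] {m k : ℕ}
    (hk : m ≤ k) : (unipotentJordanBlock R m - 1) ^ k = 0 := by
  ext i j
  rw [unipotentJordanBlock_sub_one_pow_apply, if_neg (by omega), Matrix.zero_apply]

theorem unipotentJordanBlock_pow_prime_pow {p : ℕ} [Fact p.Prime] {m n : ℕ} (hm : m ≤ p ^ n) :
    unipotentJordanBlock (ZMod p) m ^ p ^ n = 1 := by
  cases m with
  | zero => exact Subsingleton.elim _ _
  | succ m =>
    have h := sub_pow_char_pow_of_commute (p := p) (n := n)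
      (Commute.one_right (unipotentJordanBlock (ZMod p) (m + 1)))
    rw [unipotentJordanBlock_sub_one_pow_eq_zero hm, one_pow] at h
    exact (sub_eq_zero.mp h.symm)

section Reduction

variable {p : ℕ} [Fact p.Prime]

theorem ZMod.castHom_sq_eq_zero_iff (x : ZMod (p ^ 2)) :
    ZMod.castHom (dvd_pow_self p two_ne_zero) (ZMod p) x = 0 ↔ p ∣ x.val := by
  have : NeZero (p ^ 2) := ⟨pow_ne_zero 2 (Fact.out : p.Prime).ne_zero⟩
  conv_lhs => rw [← ZMod.natCast_zmod_val x, map_natCast]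
  exact ZMod.natCast_eq_zero_iff _ _

theorem ZMod.mul_eq_zero_of_castHom_sq_eq_zero {x y : ZMod (p ^ 2)}
    (hx : ZMod.castHom (dvd_pow_self p two_ne_zero) (ZMod p) x = 0)
    (hy : ZMod.castHom (dvd_pow_self p two_ne_zero) (ZMod p) y = 0) : x * y = 0 := by
  have : NeZero (p ^ 2) := ⟨pow_ne_zero 2 (Fact.out : p.Prime).ne_zero⟩
  rw [ZMod.castHom_sq_eq_zero_iff] at hx hy
  rw [← ZMod.natCast_zmod_val x, ← ZMod.natCast_zmod_val y, ← Nat.cast_mul,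
    ZMod.natCast_eq_zero_iff]
  simpa only [sq] using mul_dvd_mul hx hy

theorem ZMod.natCast_mul_ne_zero_of_castHom_sq_ne_zero {c : ℕ} {y : ZMod (p ^ 2)}
    (hc : ¬ p ^ 2 ∣ c)
    (hy : ZMod.castHom (dvd_pow_self p two_ne_zero) (ZMod p) y ≠ 0) :
    (c : ZMod (p ^ 2)) * y ≠ 0 := by
  have : NeZero (p ^ 2) := ⟨pow_ne_zero 2 (Fact.out : p.Prime).ne_zero⟩
  rw [ne_eq, ZMod.castHom_sq_eq_zero_iff] at hy
  rw [← ZMod.natCast_zmod_val y, ← Nat.cast_mul, ne_eq, ZMod.natCast_eq_zero_iff]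
  intro h
  exact hc ((((Nat.Prime.coprime_iff_not_dvd Fact.out).mpr hy).pow_left 2).dvd_of_dvd_mul_right h)

end Reduction

theorem Nat.Prime.sq_dvd_choose_prime_pow_succ {p : ℕ} (hp : p.Prime) {n k : ℕ} (hk : k ≠ 0)
    (hkn : k < p ^ n) : p ^ 2 ∣ (p ^ (n + 1)).choose k := by
  have hle : k ≤ p ^ (n + 1) := hkn.le.trans (Nat.pow_le_pow_right hp.pos n.le_succ)
  rw [hp.pow_dvd_iff_le_factorization (Nat.choose_pos hle).ne',
    Nat.factorization_choose_prime_pow hp hle hk]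
  have : k.factorization p < n := by
    refine (Nat.pow_lt_pow_iff_right hp.one_lt).mp (lt_of_le_of_lt ?_ hkn)
    exact Nat.le_of_dvd (Nat.pos_of_ne_zero hk) (Nat.ordProj_dvd k p)
  omega

theorem Nat.Prime.not_sq_dvd_choose_prime_pow_succ {p : ℕ} (hp : p.Prime) (n : ℕ) :
    ¬ p ^ 2 ∣ (p ^ (n + 1)).choose (p ^ n) := by
  have hle : p ^ n ≤ p ^ (n + 1) := Nat.pow_le_pow_right hp.pos n.le_succ
  rw [hp.pow_dvd_iff_le_factorization (Nat.choose_pos hle).ne',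
    Nat.factorization_choose_prime_pow hp hle (pow_ne_zero n hp.ne_zero)]
  simp [hp.factorization_self]

/-- for `p ≥ 3, n ≥ 2` or `p ≥ 5, n ≥ 1` and `m = p^{n-1} + 1`, the unipotent
Jordan block `x` of size `m` over `𝔽_p` is invertible with `x^{p^n} = 1`, and no matrix over
`ℤ/p²ℤ` reducing to `x` mod `p` satisfies `X^{p^n} = 1`. -/
theorem jordan_block_no_lift (p n : ℕ) [Fact p.Prime]
    (h : (3 ≤ p ∧ 2 ≤ n) ∨ (5 ≤ p ∧ 1 ≤ n)) (m : ℕ) (hm : m = p ^ (n - 1) + 1) :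
    IsUnit (unipotentJordanBlock (ZMod p) m) ∧
    unipotentJordanBlock (ZMod p) m ^ p ^ n = 1 ∧
    ∀ X : Matrix (Fin m) (Fin m) (ZMod (p ^ 2)),
      X.map (ZMod.castHom (dvd_pow_self p two_ne_zero) (ZMod p)) =
        unipotentJordanBlock (ZMod p) m →
      X ^ p ^ n ≠ 1 := by
  have hp : p.Prime := Fact.out
  obtain ⟨n, rfl⟩ : ∃ k, n = k + 1 := ⟨n - 1, by omega⟩
  rw [Nat.add_sub_cancel] at hm
  have hq : 0 < p ^ n := pow_pos hp.pos n
  have hpow : m + m ≤ p ^ (n + 1) := by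
    rw [pow_succ, hm]
    rcases h with ⟨h3, hn⟩ | ⟨h5, -⟩
    · have : p ^ 1 ≤ p ^ n := Nat.pow_le_pow_right hp.pos (by omega)
      nlinarith
    · nlinarith
  have hx := unipotentJordanBlock_pow_prime_pow (p := p) (m := m) (n := n + 1) (by omega)
  refine ⟨IsUnit.of_pow_eq_one hx (pow_ne_zero _ hp.ne_zero), hx, fun X hX hX1 => ?_⟩
  set f := ZMod.castHom (dvd_pow_self p two_ne_zero) (ZMod p) with hf
  obtain ⟨N, rfl⟩ : ∃ N, X = N + 1 := ⟨X - 1, by simp⟩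
  have hN (k : ℕ) : f.mapMatrix (N ^ k) = (unipotentJordanBlock (ZMod p) m - 1) ^ k := by
    have h1 : f.mapMatrix (N + 1) = unipotentJordanBlock (ZMod p) m := hX
    rw [map_pow, ← h1, map_add, map_one, add_sub_cancel_right]
  have hNij (k : ℕ) (i j : Fin m) : f ((N ^ k) i j) = if (i : ℕ) + k = j then 1 else 0 := by
    rw [← unipotentJordanBlock_sub_one_pow_apply, ← hN]
    rfl
  have hN0 : N ^ p ^ (n + 1) = 0 := by
    refine pow_eq_zero_of_le hpow ?_
    ext i j
    rw [pow_add, Matrix.mul_apply, Matrix.zero_apply]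
    refine Finset.sum_eq_zero fun l _ => ZMod.mul_eq_zero_of_castHom_sq_eq_zero ?_ ?_ <;>
      rw [← hf, hNij, if_neg (by omega)]
  rw [(Commute.one_right N).add_pow] at hX1
  rw [Finset.sum_eq_add_of_mem 0 (p ^ n) (by simp) (by simp; gcongr <;> omega) hq.ne] at hX1
  · simp only [pow_zero, one_pow, mul_one, Nat.choose_zero_right, Nat.cast_one,
      add_eq_left] at hX1
    have h0 := congrFun (congrFun hX1 ⟨0, by omega⟩) ⟨p ^ n, by omega⟩
    rw [← nsmul_eq_mul', Matrix.smul_apply, nsmul_eq_mul, Matrix.zero_apply] at h0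
    refine ZMod.natCast_mul_ne_zero_of_castHom_sq_ne_zero
      (hp.not_sq_dvd_choose_prime_pow_succ n) ?_ h0
    rw [← hf, hNij]
    simp
  · rintro k hk ⟨hk0, hkq⟩
    rw [one_pow, mul_one, ← nsmul_eq_mul']
    ext i j
    rw [Matrix.smul_apply, nsmul_eq_mul, Matrix.zero_apply]
    rcases lt_or_gt_of_ne hkq with hlt | hgt
    · rw [(ZMod.natCast_eq_zero_iff _ _).mpr (hp.sq_dvd_choose_prime_pow_succ hk0 hlt), zero_mul]
    · rcases (Nat.lt_succ_iff.mp (Finset.mem_range.mp hk)).eq_or_lt with rfl | hkp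
      · rw [hN0, Matrix.zero_apply, mul_zero]
      · refine ZMod.mul_eq_zero_of_castHom_sq_eq_zero ?_ ?_
        · rw [map_natCast, ZMod.natCast_eq_zero_iff]
          exact hp.dvd_choose_pow hk0 hkp.ne
        · rw [← hf, hNij, if_neg (by omega)]
end
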